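/- Let D ∈ ℝ^{n×n} be positive semidefinite, d ∈ ℝ^n, L(w,λ) = (1/2)w'Dw + w'd − (1/2)λ(w'w − 1), W = {w ∈ ℝ^n : w'w = 1}, and let λ_P be the largest real eigenvalue of P = [[D, I],[dd', D]]. Then the pairs (w*, λ*) with λ* = λ_P and w* ∈ (−(D − ‖D‖I)⁺d + N(D − ‖D‖I)) ∩ W when λ_P = ‖D‖, or w* = −(D − λ_P I)^{−1}d when λ_P > ‖D‖, are saddle points of L: L(w,λ*) ≤ L(w*,λ*) ≤ L(w*,λ) for all w ∈ ℝ^n and λ ∈ ℝ. -/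

import Mathlib

open Matrix Set

noncomputable section

/-- `Ap` is the Moore–Penrose pseudoinverse of `A`. -/
def IsMoorePenrose {m n : Type*} [Fintype m] [Fintype n] (A : Matrix m n ℝ)
    (Ap : Matrix n m ℝ) : Prop :=
  A * Ap * A = A ∧ Ap * A * Ap = Ap ∧ (A * Ap)ᵀ = A * Ap ∧ (Ap * A)ᵀ = Ap * A

/-- The spectral norm of a real square matrix: `sup {|v'Av| : ‖v‖ = 1}` (for a symmetric
positive semidefinite matrix this is the largest eigenvalue). -/
def specNorm {n : Type*} [Fintype n] (A : Matrix n n ℝ) : ℝ :=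
  sSup {r | ∃ v : n → ℝ, v ⬝ᵥ v = 1 ∧ r = |v ⬝ᵥ A.mulVec v|}

lemma aux_abs_le {n : ℕ} (D : Matrix (Fin n) (Fin n) ℝ) (v : Fin n → ℝ) (hv : v ⬝ᵥ v = 1) :
    |v ⬝ᵥ D.mulVec v| ≤ ∑ i, ∑ j, |D i j| := by
  have h1 : ∀ i, |v i| ≤ 1 := by
    intro i
    have h : v i * v i ≤ v ⬝ᵥ v :=
      Finset.single_le_sum (f := fun i => v i * v i) (fun j _ => mul_self_nonneg _)
        (Finset.mem_univ i)
    rw [hv] at h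
    exact abs_le_one_iff_mul_self_le_one.mpr h
  simp only [dotProduct, mulVec, Finset.mul_sum]
  refine (Finset.abs_sum_le_sum_abs _ _).trans (Finset.sum_le_sum fun i _ => ?_)
  refine (Finset.abs_sum_le_sum_abs _ _).trans (Finset.sum_le_sum fun j _ => ?_)
  rw [abs_mul, abs_mul]
  have a := h1 i
  have b := h1 j
  have hab : |v i| * |v j| ≤ 1 := mul_le_one₀ a (abs_nonneg _) b
  calc |v i| * (|D i j| * |v j|) = (|v i| * |v j|) * |D i j| := by ring
    _ ≤ 1 * |D i j| := mul_le_mul_of_nonneg_right hab (abs_nonneg _)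
    _ = _ := one_mul _

lemma aux_quad_le {n : ℕ} (D : Matrix (Fin n) (Fin n) ℝ) (v : Fin n → ℝ) :
    v ⬝ᵥ D.mulVec v ≤ specNorm D * (v ⬝ᵥ v) := by
  by_cases h0 : v = 0
  · subst h0; simp
  have hpos : 0 < v ⬝ᵥ v := by
    rcases lt_or_eq_of_le (show 0 ≤ v ⬝ᵥ v from Finset.sum_nonneg fun i _ => mul_self_nonneg _)
      with h | h
    · exact h
    · exact absurd (dotProduct_self_eq_zero.mp h.symm) h0
  set r := Real.sqrt (v ⬝ᵥ v) with hr
  have hr0 : 0 < r := Real.sqrt_pos.mpr hpos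
  have hrr : r * r = v ⬝ᵥ v := Real.mul_self_sqrt hpos.le
  have hu : (r⁻¹ • v) ⬝ᵥ (r⁻¹ • v) = 1 := by
    simp only [smul_dotProduct, dotProduct_smul, smul_eq_mul, ← hrr]
    field_simp
  have hb : |(r⁻¹ • v) ⬝ᵥ D.mulVec (r⁻¹ • v)| ≤ specNorm D := by
    refine le_csSup ⟨∑ i, ∑ j, |D i j|, ?_⟩ ⟨_, hu, rfl⟩
    rintro x ⟨u, hu, rfl⟩
    exact aux_abs_le D u hu
  have hc := (le_abs_self _).trans hb
  simp only [mulVec_smul, smul_dotProduct, dotProduct_smul, smul_eq_mul] at hc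
  rw [← hrr]
  have : v ⬝ᵥ D.mulVec v = (r⁻¹ * (r⁻¹ * (v ⬝ᵥ D.mulVec v))) * (r * r) := by
    field_simp
  rw [this]
  exact mul_le_mul_of_nonneg_right hc (by positivity)

lemma aux_symm {n : ℕ} (D : Matrix (Fin n) (Fin n) ℝ) (hD : Dᵀ = D) (x y : Fin n → ℝ) :
    x ⬝ᵥ D.mulVec y = y ⬝ᵥ D.mulVec x := by
  rw [dotProduct_mulVec, ← mulVec_transpose, hD, dotProduct_comm]

lemma aux_saddle {n : ℕ} (D : Matrix (Fin n) (Fin n) ℝ) (hD : Dᵀ = D) (d w : Fin n → ℝ) (l : ℝ)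
    (hl : ∀ v, v ⬝ᵥ D.mulVec v ≤ l * (v ⬝ᵥ v))
    (hg : d = l • w - D.mulVec w) (hw : w ⬝ᵥ w = 1) :
    let L : (Fin n → ℝ) → ℝ → ℝ := fun w lam =>
      (1/2) * (w ⬝ᵥ D.mulVec w) + w ⬝ᵥ d - (1/2) * lam * (w ⬝ᵥ w - 1)
    (∀ w' : Fin n → ℝ, L w' l ≤ L w l) ∧ (∀ lam : ℝ, L w l ≤ L w lam) := by
  intro L
  refine ⟨fun x => ?_, fun lam => by simp [L, hw]⟩
  have h := hl (x - w)
  have hs := aux_symm D hD x w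
  have hc := dotProduct_comm x w
  simp only [L, hg]
  simp only [mulVec_sub, dotProduct_sub, sub_dotProduct, dotProduct_smul, smul_eq_mul] at h ⊢
  rw [hc] at *
  rw [hs] at *
  nlinarith

lemma aux_unit {n : ℕ} (D : Matrix (Fin n) (Fin n) ℝ) (l : ℝ) (hl : specNorm D < l) :
    IsUnit (l • (1 : Matrix (Fin n) (Fin n) ℝ) - D) := by
  rw [← mulVec_injective_iff_isUnit]
  intro x y hxy
  have h : (l • (1 : Matrix (Fin n) (Fin n) ℝ) - D).mulVec (x - y) = 0 := by
    rw [mulVec_sub]; exact sub_eq_zero.mpr hxy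
  have h2 := congrArg (fun z => (x - y) ⬝ᵥ z) h
  simp only [sub_mulVec, smul_mulVec, one_mulVec, dotProduct_sub (x - y), dotProduct_smul,
    smul_eq_mul, dotProduct_zero] at h2
  rw [← dotProduct_sub] at h2
  have h3 := aux_quad_le D (x - y)
  have h4 : 0 ≤ (x - y) ⬝ᵥ (x - y) := Finset.sum_nonneg fun i _ => mul_self_nonneg _
  have h5 : (x - y) ⬝ᵥ (x - y) = 0 := by nlinarith
  exact sub_eq_zero.mp (dotProduct_self_eq_zero.mp h5)

lemma aux_inv {n : ℕ} (D : Matrix (Fin n) (Fin n) ℝ) (l : ℝ) (hl : specNorm D < l)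
    (d : Fin n → ℝ) :
    l • ((l • (1 : Matrix (Fin n) (Fin n) ℝ) - D)⁻¹.mulVec d) -
      D.mulVec ((l • (1 : Matrix (Fin n) (Fin n) ℝ) - D)⁻¹.mulVec d) = d := by
  have hu := (isUnit_iff_isUnit_det _).mp (aux_unit D l hl)
  have : (l • (1 : Matrix (Fin n) (Fin n) ℝ) - D).mulVec
      ((l • (1 : Matrix (Fin n) (Fin n) ℝ) - D)⁻¹.mulVec d) = d := by
    rw [mulVec_mulVec, mul_nonsing_inv _ hu, one_mulVec]
  rwa [sub_mulVec, smul_mulVec, one_mulVec] at this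

lemma aux_uniq {n : ℕ} (D : Matrix (Fin n) (Fin n) ℝ) (l : ℝ) (hl : specNorm D < l)
    (x y : Fin n → ℝ) (h : l • x - D.mulVec x = l • y - D.mulVec y) : x = y := by
  apply (mulVec_injective_iff_isUnit.mpr (aux_unit D l hl))
  simpa [sub_mulVec, smul_mulVec] using h

lemma aux_exists {n : ℕ} (D : Matrix (Fin n) (Fin n) ℝ) (hD : Dᵀ = D) (d e : Fin n → ℝ)
    (he : D.mulVec e = specNorm D • e) (hne : e ≠ 0) (hde : e ⬝ᵥ d = e ⬝ᵥ e) :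
    ∃ μ, specNorm D < μ ∧ ((μ • (1 : Matrix (Fin n) (Fin n) ℝ) - D)⁻¹.mulVec d) ⬝ᵥ
      ((μ • (1 : Matrix (Fin n) (Fin n) ℝ) - D)⁻¹.mulVec d) = 1 := by
  set s := specNorm D with hs
  have cs : ∀ x y : Fin n → ℝ, (x ⬝ᵥ y)^2 ≤ (x ⬝ᵥ x) * (y ⬝ᵥ y) := by
    intro x y
    have := Finset.sum_mul_sq_le_sq_mul_sq Finset.univ x y
    simpa [dotProduct, pow_two] using this
  have nn : ∀ x : Fin n → ℝ, 0 ≤ x ⬝ᵥ x := fun x => Finset.sum_nonneg fun i _ => mul_self_nonneg _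
  have hepos : 0 < e ⬝ᵥ e := lt_of_le_of_ne (nn e)
    fun h => hne (dotProduct_self_eq_zero.mp h.symm)
  have hed : e ⬝ᵥ e ≤ d ⬝ᵥ d := by
    have := cs e d
    rw [hde] at this
    nlinarith
  have hdpos : 0 < d ⬝ᵥ d := lt_of_lt_of_le hepos hed
  set W : ℝ → (Fin n → ℝ) := fun μ => (μ • (1 : Matrix (Fin n) (Fin n) ℝ) - D)⁻¹.mulVec d with hW
  set a := Real.sqrt (e ⬝ᵥ e)
  set b := Real.sqrt (d ⬝ᵥ d)
  have ha : 0 < a := Real.sqrt_pos.mpr hepos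
  have hb : 0 < b := Real.sqrt_pos.mpr hdpos
  have haa : a * a = e ⬝ᵥ e := Real.mul_self_sqrt hepos.le
  have hbb : b * b = d ⬝ᵥ d := Real.mul_self_sqrt hdpos.le
  have hab : a ≤ b := Real.sqrt_le_sqrt hed
  have hcont : ContinuousOn (fun μ => W μ ⬝ᵥ W μ) (Icc (s + a) (s + b)) := by
    have hWc : ContinuousOn W (Icc (s + a) (s + b)) := by
      intro μ hμ
      have hu := (isUnit_iff_isUnit_det _).mp (aux_unit D μ (by rw [← hs]; linarith [hμ.1]))
      have hM : Continuous fun μ : ℝ => μ • (1 : Matrix (Fin n) (Fin n) ℝ) - D := by fun_prop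
      have hi : ContinuousAt (fun μ : ℝ => (μ • (1 : Matrix (Fin n) (Fin n) ℝ) - D)⁻¹) μ := by
        simp only [inv_def, Ring.inverse_eq_inv']
        exact (hM.matrix_det.continuousAt.inv₀ hu.ne_zero).smul hM.matrix_adjugate.continuousAt
      have : Continuous fun M : Matrix (Fin n) (Fin n) ℝ => M.mulVec d :=
        continuous_id.matrix_mulVec continuous_const
      exact (this.continuousAt.comp hi).continuousWithinAt
    have : Continuous fun x : Fin n → ℝ => x ⬝ᵥ x := continuous_id.dotProduct continuous_id
    exact this.comp_continuousOn hWc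
  have hlow : 1 ≤ W (s + a) ⬝ᵥ W (s + a) := by
    have h := aux_inv D (s + a) (by rw [← hs]; linarith) d
    change (s + a) • W (s + a) - D.mulVec (W (s + a)) = d at h
    have h2 := congrArg (fun z => e ⬝ᵥ z) h
    simp only [dotProduct_sub, dotProduct_smul, smul_eq_mul] at h2
    rw [aux_symm D hD, he, dotProduct_smul, smul_eq_mul, dotProduct_comm (W _) e, hde, ← haa] at h2
    have h3 : e ⬝ᵥ W (s + a) = a := by
      have : a * (e ⬝ᵥ W (s + a)) = a * a := by linarith
      exact mul_left_cancel₀ ha.ne' this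
    have h4 := cs e (W (s + a))
    rw [h3, ← haa] at h4
    have : 0 < a * a := by positivity
    nlinarith
  have hup : W (s + b) ⬝ᵥ W (s + b) ≤ 1 := by
    have h := aux_inv D (s + b) (by rw [← hs]; linarith) d
    change (s + b) • W (s + b) - D.mulVec (W (s + b)) = d at h
    have h2 := congrArg (fun z => W (s + b) ⬝ᵥ z) h
    simp only [dotProduct_sub, dotProduct_smul, smul_eq_mul] at h2
    have h3 := aux_quad_le D (W (s + b))
    rw [← hs] at h3
    have h4 := cs (W (s + b)) d
    rw [← hbb] at h4
    set t := W (s + b) ⬝ᵥ W (s + b)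
    have h5 : b * t ≤ W (s + b) ⬝ᵥ d := by linarith
    have ht : 0 ≤ t := nn _
    have h6 : (b * t)^2 ≤ t * (b * b) := (pow_le_pow_left₀ (by positivity) h5 2).trans h4
    by_contra hc
    push Not at hc
    have : 0 < b * b * t * (t - 1) := by
      have := sub_pos.mpr hc
      have : 0 < t := by linarith
      positivity
    nlinarith
  obtain ⟨μ, hμ, h1⟩ := intermediate_value_Icc' (by linarith) hcont ⟨hup, hlow⟩
  exact ⟨μ, by linarith [hμ.1], h1⟩

/-- Saddle points of the Lagrangian of constrained quadratic optimization: for `D ⪰ 0`,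
`L(w,λ) = (1/2)w'Dw + w'd − (1/2)λ(w'w−1)`, `W = {w : w'w = 1}`, and `λ_P` the largest
real eigenvalue of `P = [[D,I],[dd',D]]`, the pairs `(w*, λ*)` with `λ* = λ_P` and
`w* ∈ (−(D−‖D‖I)⁺d + N(D−‖D‖I)) ∩ W` when `λ_P = ‖D‖`, or `w* = −(D−λ_P I)⁻¹d` when
`λ_P > ‖D‖`, are saddle points of `L`:
`L(w,λ*) ≤ L(w*,λ*) ≤ L(w*,λ)` for all `w ∈ ℝⁿ` and `λ ∈ ℝ`. -/
theorem stmt17 {n : ℕ} (D : Matrix (Fin n) (Fin n) ℝ) (hD : D.PosSemidef)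
    (d : Fin n → ℝ) (lamP : ℝ)
    (hlamP : IsGreatest
      {μ : ℝ | ∃ v : Fin n ⊕ Fin n → ℝ, v ≠ 0 ∧
        (Matrix.fromBlocks D 1 (Matrix.vecMulVec d d) D).mulVec v = μ • v} lamP)
    (DNp : Matrix (Fin n) (Fin n) ℝ)
    (hDNp : IsMoorePenrose (D - specNorm D • 1) DNp) :
    let L : (Fin n → ℝ) → ℝ → ℝ := fun w lam =>
      (1/2) * (w ⬝ᵥ D.mulVec w) + w ⬝ᵥ d - (1/2) * lam * (w ⬝ᵥ w - 1)
    (lamP = specNorm D →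
      ∀ w : Fin n → ℝ,
        (∃ q, (D - specNorm D • 1).mulVec q = 0 ∧ w = -DNp.mulVec d + q) → w ⬝ᵥ w = 1 →
          (∀ w' : Fin n → ℝ, L w' lamP ≤ L w lamP) ∧ (∀ lam : ℝ, L w lamP ≤ L w lam)) ∧
    (lamP > specNorm D →
      (∀ w' : Fin n → ℝ, L w' lamP ≤ L (-(D - lamP • 1)⁻¹.mulVec d) lamP) ∧
      (∀ lam : ℝ, L (-(D - lamP • 1)⁻¹.mulVec d) lamP ≤
        L (-(D - lamP • 1)⁻¹.mulVec d) lam)) := by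
  have hDt : Dᵀ = D := by
    have := hD.isHermitian
    simpa [Matrix.IsHermitian, conjTranspose_eq_transpose_of_trivial] using this
  have key : ∀ (μ : ℝ) (x y : Fin n → ℝ),
      (Matrix.fromBlocks D 1 (Matrix.vecMulVec d d) D).mulVec (Sum.elim x y) = μ • Sum.elim x y ↔
      (μ • x - D.mulVec x = y ∧ μ • y - D.mulVec y = (d ⬝ᵥ x) • d) := by
    intro μ x y
    have hr : μ • (Sum.elim x y : Fin n ⊕ Fin n → ℝ) = Sum.elim (μ • x) (μ • y) := by
      ext i; cases i <;> simp
    have hv : (vecMulVec d d).mulVec x = (d ⬝ᵥ x) • d := by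
      ext i
      simp [vecMulVec_mulVec, mul_comm]
    rw [hr, fromBlocks_mulVec, Sum.elim_eq_iff]
    simp only [Sum.elim_comp_inl, Sum.elim_comp_inr, one_mulVec, hv]
    constructor
    · rintro ⟨h1, h2⟩
      exact ⟨by rw [← h1]; simp, by rw [← h2]; simp⟩
    · rintro ⟨h1, h2⟩
      exact ⟨by rw [← h1]; simp, by rw [← h2]; simp⟩
  intro L
  constructor
  · intro hl w hw hww
    obtain ⟨q, hq, rfl⟩ := hw
    obtain ⟨hA1, hA2, hA3, hA4⟩ := hDNp
    set A := D - specNorm D • (1 : Matrix (Fin n) (Fin n) ℝ) with hA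
    have hAt : Aᵀ = A := by simp [hA, hDt]
    have hAA : A * (A * DNp) = A := by
      have h := congrArg transpose hA1
      rw [transpose_mul, hA3, hAt] at h
      exact h
    set e := d - (A * DNp).mulVec d with he
    have hAe : A.mulVec e = 0 := by
      rw [he, mulVec_sub, mulVec_mulVec, hAA, sub_self]
    have hDe : D.mulVec e = specNorm D • e := by
      rw [hA, sub_mulVec, smul_mulVec, one_mulVec] at hAe
      exact sub_eq_zero.mp hAe
    have hed : e ⬝ᵥ d = e ⬝ᵥ e := by
      have h0 : e ⬝ᵥ (A * DNp).mulVec d = 0 := by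
        rw [← mulVec_mulVec, aux_symm A hAt, hAe, dotProduct_zero]
      have : d = e + (A * DNp).mulVec d := by rw [he]; simp
      calc e ⬝ᵥ d = e ⬝ᵥ (e + (A * DNp).mulVec d) := by rw [← this]
        _ = _ := by rw [dotProduct_add, h0, add_zero]
    have he0 : e = 0 := by
      by_contra hne
      obtain ⟨μ, hμ, h1⟩ := aux_exists D hDt d e hDe hne hed
      set w := (μ • (1 : Matrix (Fin n) (Fin n) ℝ) - D)⁻¹.mulVec d with hw
      have i1 := aux_inv D μ hμ d
      have i2 := aux_inv D μ hμ w
      rw [← hw] at i1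
      set x := (μ • (1 : Matrix (Fin n) (Fin n) ℝ) - D)⁻¹.mulVec w with hx
      have hdx : d ⬝ᵥ x = 1 := by
        rw [← h1]
        nth_rewrite 1 [← i1]
        nth_rewrite 4 [← i2]
        simp only [sub_dotProduct, dotProduct_sub, smul_dotProduct, dotProduct_smul]
        rw [aux_symm D hDt w x, dotProduct_comm x]
      have := hlamP.2 (show μ ∈ _ from ⟨Sum.elim x w, ?_, (key μ x w).mpr ⟨i2, ?_⟩⟩)
      · linarith
      · intro h0
        have : w = 0 := by
          ext i; exact congrFun h0 (Sum.inr i)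
        rw [this] at h1
        simp at h1
      · rw [hdx, one_smul, i1]
    refine aux_saddle D hDt d _ lamP (fun v => hl ▸ aux_quad_le D v) ?_ hww
    have hd : d = (A * DNp).mulVec d := sub_eq_zero.mp he0
    have h2 : A.mulVec (-DNp.mulVec d + q) = -d := by
      rw [mulVec_add, hq, mulVec_neg, mulVec_mulVec, ← hd, add_zero]
    rw [hA, sub_mulVec, smul_mulVec, one_mulVec, ← hl] at h2
    rw [← neg_sub, h2, neg_neg]
  · intro hl
    have hinv : -(D - lamP • (1 : Matrix (Fin n) (Fin n) ℝ))⁻¹.mulVec d =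
        (lamP • (1 : Matrix (Fin n) (Fin n) ℝ) - D)⁻¹.mulVec d := by
      apply aux_uniq D lamP hl
      rw [aux_inv D lamP hl]
      have hu := (isUnit_iff_isUnit_det _).mp (aux_unit D lamP hl).neg
      rw [neg_sub] at hu
      have : (D - lamP • (1 : Matrix (Fin n) (Fin n) ℝ)).mulVec
          ((D - lamP • (1 : Matrix (Fin n) (Fin n) ℝ))⁻¹.mulVec d) = d := by
        rw [mulVec_mulVec, mul_nonsing_inv _ hu, one_mulVec]
      rw [sub_mulVec, smul_mulVec, one_mulVec] at this
      rw [mulVec_neg, smul_neg]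
      nth_rewrite 3 [← this]
      abel
    rw [hinv]
    have i1 := aux_inv D lamP hl d
    set w := (lamP • (1 : Matrix (Fin n) (Fin n) ℝ) - D)⁻¹.mulVec d with hw
    refine aux_saddle D hDt d w lamP (fun v => ?_) i1.symm ?_
    · refine (aux_quad_le D v).trans (mul_le_mul_of_nonneg_right hl.le ?_)
      exact Finset.sum_nonneg fun i _ => mul_self_nonneg _
    · obtain ⟨v, hv0, hv⟩ := hlamP.1
      obtain ⟨x, y, rfl⟩ : ∃ x y, v = Sum.elim x y :=
        ⟨v ∘ Sum.inl, v ∘ Sum.inr, (Sum.elim_comp_inl_inr v).symm⟩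
      obtain ⟨h1, h2⟩ := (key _ _ _).mp hv
      have hy : y = (d ⬝ᵥ x) • w := by
        apply aux_uniq D lamP hl
        rw [h2, mulVec_smul, smul_comm, ← smul_sub, i1]
      have hc : d ⬝ᵥ x ≠ 0 := by
        intro hc
        rw [hc, zero_smul] at hy
        have hx : x = 0 := by
          apply aux_uniq D lamP hl
          rw [h1, hy]; simp
        apply hv0
        rw [hx, hy]
        ext i; cases i <;> rfl
      have h3 : d ⬝ᵥ x = w ⬝ᵥ y := by
        rw [← h1]
        nth_rewrite 1 [← i1]
        simp only [sub_dotProduct, dotProduct_sub, smul_dotProduct, dotProduct_smul]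
        rw [aux_symm D hDt w x, dotProduct_comm x]
      rw [hy, dotProduct_smul, smul_eq_mul] at h3
      exact mul_left_cancel₀ hc (by rw [← h3, mul_one])
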